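/- Let X be a nonempty finite set, let ∅ ≠ A ⊆ B ⊆ 2^X with ∅ ∉ A (so that ⟨A⟩ is a nontrivial upper set), let ε ∈ (0,1), and let p ∈ (0,1). If r_{A,B}(p) ≥ 1 and p > 48 · q(⟨A⟩) · log₂(ℓ_0(⟨A⟩)/ε), then P(X_p ∈ A | X_p ∈ B) > 1 − ε. -/

import Mathlib

open Finset

noncomputable section

/-- Product measure weight of a single subset `S` of the finite type `X`. -/
def mu {X : Type*} [Fintype X] [DecidableEq X] (p : ℝ) (S : Finset X) : ℝ :=
  p ^ S.card * (1 - p) ^ (Fintype.card X - S.card)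

/-- Measure of a family of subsets. -/
def muF {X : Type*} [Fintype X] [DecidableEq X] (p : ℝ) (F : Finset (Finset X)) : ℝ :=
  ∑ S ∈ F, mu p S

/-- `F` is an upper set (increasing family) in `2^X`. -/
def IsUpperFam {X : Type*} [Fintype X] [DecidableEq X] (F : Finset (Finset X)) : Prop :=
  ∀ S ∈ F, ∀ T : Finset X, S ⊆ T → T ∈ F

/-- `G` is a cover of `F`: every member of `F` contains a member of `G`. -/
def IsCover {X : Type*} [Fintype X] [DecidableEq X] (G F : Finset (Finset X)) : Prop :=
  ∀ S ∈ F, ∃ T ∈ G, T ⊆ S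

/-- `F` is `p`-small. -/
def PSmall {X : Type*} [Fintype X] [DecidableEq X] (p : ℝ) (F : Finset (Finset X)) : Prop :=
  ∃ G : Finset (Finset X), IsCover G F ∧ ∑ T ∈ G, p ^ T.card ≤ 1 / 2

/-- Expectation threshold: the largest `p ∈ [0,1]` for which `F` is `p`-small. -/
def qThr {X : Type*} [Fintype X] [DecidableEq X] (F : Finset (Finset X)) : ℝ :=
  sSup {p : ℝ | p ∈ Set.Icc (0 : ℝ) 1 ∧ PSmall p F}

/-- The set of minimal elements of `F` (under inclusion). -/
def minimalsF {X : Type*} [Fintype X] [DecidableEq X] (F : Finset (Finset X)) :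
    Finset (Finset X) :=
  F.filter fun S => ∀ T ∈ F, T ⊆ S → T = S

/-- `ℓ₀(F)`: maximum size of a minimal element of `F`. -/
def ell0 {X : Type*} [Fintype X] [DecidableEq X] (F : Finset (Finset X)) : ℕ :=
  (minimalsF F).sup Finset.card

/-- `ℓ(F) = max (ℓ₀(F), 2)`. -/
def ell {X : Type*} [Fintype X] [DecidableEq X] (F : Finset (Finset X)) : ℕ :=
  max (ell0 F) 2

/-- The upper set generated by a family `A`. -/
def upClos {X : Type*} [Fintype X] [DecidableEq X] (A : Finset (Finset X)) :
    Finset (Finset X) :=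
  Finset.univ.filter fun T => ∃ S ∈ A, S ⊆ T

/-- The ratio `r_{A,B}(p) = (μ_p(A)/μ_p(⟨A⟩)) / μ_p(B)`. -/
def rAB {X : Type*} [Fintype X] [DecidableEq X] (A B : Finset (Finset X)) (p : ℝ) : ℝ :=
  (muF p A / muF p (upClos A)) / muF p B

end

section ParkPham

variable {X : Type*} [Fintype X] [DecidableEq X]

lemma mu_nonneg {p : ℝ} (hp0 : 0 ≤ p) (hp1 : p ≤ 1) (S : Finset X) : 0 ≤ mu p S :=
  mul_nonneg (pow_nonneg hp0 _) (pow_nonneg (by linarith) _)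

lemma sum_mu (p : ℝ) : ∑ S : Finset X, mu p S = 1 := by
  unfold mu
  rw [Fintype.sum_pow_mul_eq_add_pow]
  simp

lemma sum_mu_union_eq (b : ℝ) {W Z : Finset X} (h : W ⊆ Z) :
    ∑ V with W ∪ V = Z, mu b V = b ^ (#Z - #W) * (1 - b) ^ (Fintype.card X - #Z) := by
  have hZ := card_le_univ Z
  have hWZ := card_le_card h
  have key : ∑ V with W ∪ V = Z, mu b V = ∑ V ∈ W.powerset,
      b ^ (#Z - #W) * (1 - b) ^ (Fintype.card X - #Z) * (b ^ #V * (1 - b) ^ (#W - #V)) := by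
    refine Finset.sum_bij' (fun V _ => V ∩ W) (fun V _ => (Z \ W) ∪ V) ?_ ?_ ?_ ?_ ?_
    · intro V _
      simp
    · intro V hV
      simp only [mem_powerset, mem_filter, mem_univ, true_and] at hV ⊢
      grind
    · intro V hV
      simp only [mem_filter, mem_univ, true_and] at hV
      subst hV
      ext x
      simp
      tauto
    · intro V hV
      simp only [mem_powerset] at hV
      grind
    · intro V hV
      simp only [mem_filter, mem_univ, true_and] at hV
      have h1 : #V = (#Z - #W) + #(V ∩ W) := by
        have h2 := card_union_add_card_inter W V
        rw [hV, inter_comm] at h2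
        omega
      have h3 : #(V ∩ W) ≤ #W := card_le_card inter_subset_right
      have h4 : Fintype.card X - #V = (Fintype.card X - #Z) + (#W - #(V ∩ W)) := by omega
      unfold mu
      rw [h4, pow_add]
      nth_rewrite 1 [h1]
      rw [pow_add]
      ring
  rw [key, ← Finset.mul_sum, Finset.sum_pow_mul_eq_add_pow]
  simp

/-- The union of independent random sets of densities `a` and `b` has density
`1 - (1 - a) * (1 - b)`. -/
lemma sum_mu_mul_sum_mu_union (a b : ℝ) (φ : Finset X → ℝ) :
    ∑ W, mu a W * ∑ V, mu b V * φ (W ∪ V) = ∑ Z, mu (1 - (1 - a) * (1 - b)) Z * φ Z := by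
  have h1 : ∀ W : Finset X, ∑ V, mu b V * φ (W ∪ V) =
      ∑ Z, if W ⊆ Z then b ^ (#Z - #W) * (1 - b) ^ (Fintype.card X - #Z) * φ Z else 0 := by
    intro W
    rw [← Finset.sum_fiberwise univ (fun V => W ∪ V)]
    refine Finset.sum_congr rfl fun Z _ => ?_
    split_ifs with h
    · rw [← sum_mu_union_eq b h, Finset.sum_mul]
      refine Finset.sum_congr rfl fun V hV => ?_
      rw [(mem_filter.1 hV).2]
    · refine Finset.sum_eq_zero fun V hV => ?_
      exact absurd ((mem_filter.1 hV).2 ▸ subset_union_left) h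
  simp_rw [h1, Finset.mul_sum]
  rw [Finset.sum_comm]
  refine Finset.sum_congr rfl fun Z _ => ?_
  have hZ := card_le_univ Z
  have h2 : ∀ W ∈ Z.powerset, mu a W * (b ^ (#Z - #W) * (1 - b) ^ (Fintype.card X - #Z) * φ Z) =
      a ^ #W * ((1 - a) * b) ^ (#Z - #W) *
        (((1 - a) * (1 - b)) ^ (Fintype.card X - #Z) * φ Z) := by
    intro W hW
    have hWZ := card_le_card (mem_powerset.1 hW)
    have h4 : Fintype.card X - #W = (#Z - #W) + (Fintype.card X - #Z) := by omega
    unfold mu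
    rw [h4, pow_add, mul_pow, mul_pow]
    ring
  calc _ = ∑ W ∈ Z.powerset,
        mu a W * (b ^ (#Z - #W) * (1 - b) ^ (Fintype.card X - #Z) * φ Z) := by
        rw [← Finset.sum_subset (subset_univ Z.powerset)]
        · exact Finset.sum_congr rfl fun W hW => by rw [if_pos (mem_powerset.1 hW)]
        · intro W _ hW
          rw [if_neg (fun h => hW (mem_powerset.2 h)), mul_zero]
    _ = _ := by
        rw [Finset.sum_congr rfl h2, ← Finset.sum_mul, Finset.sum_pow_mul_eq_add_pow]
        unfold mu
        ring

/-- The probability that a random set of density `p` contains no member of `H`. -/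
noncomputable def avoidProb (p : ℝ) (H : Finset (Finset X)) : ℝ :=
  ∑ W, mu p W * if ∀ S ∈ H, ¬ S ⊆ W then 1 else 0

lemma avoidProb_le_one {p : ℝ} (hp0 : 0 ≤ p) (hp1 : p ≤ 1) (H : Finset (Finset X)) :
    avoidProb p H ≤ 1 := by
  rw [← sum_mu (X := X) p]
  refine Finset.sum_le_sum fun W _ => ?_
  have := mu_nonneg hp0 hp1 W
  split_ifs <;> simp [this]

lemma avoidProb_eq_zero {p : ℝ} {H : Finset (Finset X)} (h : ∅ ∈ H) : avoidProb p H = 0 :=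
  Finset.sum_eq_zero fun W _ => by
    rw [if_neg (fun hW => hW ∅ h (empty_subset W)), mul_zero]

lemma exists_minimalsF_subset {F : Finset (Finset X)} {S : Finset X} (hS : S ∈ F) :
    ∃ T ∈ minimalsF F, T ⊆ S := by
  obtain ⟨T, hTS, hT⟩ := F.exists_le_minimal hS
  refine ⟨T, mem_filter.2 ⟨hT.prop, fun U hU hUT => ?_⟩, hTS⟩
  exact hUT.antisymm (hT.le_of_le hU hUT)

/-- The minimal fragments `S \ W`, `S ∈ H`. -/
def minFragments (H : Finset (Finset X)) (W : Finset X) : Finset (Finset X) :=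
  minimalsF (H.image (· \ W))

lemma exists_of_mem_minFragments {H : Finset (Finset X)} {W T : Finset X}
    (hT : T ∈ minFragments H W) : ∃ S ∈ H, S \ W = T :=
  mem_image.1 (mem_filter.1 hT).1

lemma disjoint_of_mem_minFragments {H : Finset (Finset X)} {W T : Finset X}
    (hT : T ∈ minFragments H W) : Disjoint W T := by
  obtain ⟨S, -, rfl⟩ := exists_of_mem_minFragments hT
  exact disjoint_sdiff

/-- A minimal fragment of `W` is contained in every edge inside `W ∪ T`. -/
lemma minFragments_subset {H : Finset (Finset X)} {W T S : Finset X}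
    (hT : T ∈ minFragments H W) (hS : S ∈ H) (hSZ : S ⊆ W ∪ T) : T ⊆ S := by
  have h := (mem_filter.1 hT).2 (S \ W) (mem_image_of_mem _ hS) (sdiff_le_iff.2 hSZ)
  rw [← h]
  exact sdiff_subset

lemma card_filter_powerset_le {α : Type*} [DecidableEq α] {m : ℕ} {S : Finset α} (hS : #S ≤ 2 * m + 1) :
    #{T ∈ S.powerset | m < #T} ≤ 4 ^ m := by
  have h1 : #{T ∈ S.powerset | m < #T} ≤ #{T ∈ S.powerset | ¬ m < #T} := by
    refine card_le_card_of_injOn (fun T => S \ T) ?_ ?_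
    · intro T hT
      simp only [coe_filter, mem_powerset, Set.mem_ofPred_eq] at hT ⊢
      refine ⟨sdiff_subset, ?_⟩
      rw [card_sdiff_of_subset hT.1]
      omega
    · intro T hT U hU h
      simp only [coe_filter, mem_powerset, Set.mem_ofPred_eq] at hT hU
      dsimp only at h
      rw [← Finset.sdiff_sdiff_eq_self hT.1, h, Finset.sdiff_sdiff_eq_self hU.1]
  have h2 := card_filter_add_card_filter_not (s := S.powerset) (fun T => m < #T)
  rw [card_powerset] at h2
  have h3 : 2 ^ #S ≤ 2 * 4 ^ m := by
    calc 2 ^ #S ≤ 2 ^ (2 * m + 1) := Nat.pow_le_pow_right (by norm_num) hS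
      _ = 2 * 4 ^ m := by rw [pow_succ, pow_mul]; ring
  omega

/-- The total `q`-weight of the minimal fragments of size larger than `m`. -/
noncomputable def largeFragmentCost (q : ℝ) (m : ℕ) (H : Finset (Finset X)) (W : Finset X) : ℝ :=
  ∑ T ∈ minFragments H W with m < #T, q ^ #T

lemma mu_mul_pow_le {q w : ℝ} (hq : 0 ≤ q) (hw0 : 0 < w) (hw1 : w ≤ 1) (hqw : 16 * q ≤ w)
    {W T : Finset X} (h : Disjoint W T) :
    mu w W * q ^ #T ≤ mu w (W ∪ T) * (1 / 16) ^ #T := by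
  have hc := card_union_of_disjoint h
  have hZ := card_le_univ (W ∪ T)
  have h4 : Fintype.card X - #W = (Fintype.card X - (#W + #T)) + #T := by omega
  have h5 : q ^ #T ≤ w ^ #T * (1 / 16) ^ #T := by
    rw [← mul_pow]
    exact pow_le_pow_left₀ hq (by linarith) _
  have h6 : (1 - w) ^ #T ≤ 1 := pow_le_one₀ (by linarith) (by linarith)
  have h7 : 0 ≤ w ^ #W * (1 - w) ^ (Fintype.card X - (#W + #T)) :=
    mul_nonneg (pow_nonneg hw0.le _) (pow_nonneg (by linarith) _)
  unfold mu
  rw [hc, h4, pow_add, pow_add]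
  calc _ = w ^ #W * (1 - w) ^ (Fintype.card X - (#W + #T)) * ((1 - w) ^ #T * q ^ #T) := by ring
    _ ≤ w ^ #W * (1 - w) ^ (Fintype.card X - (#W + #T)) * (1 * (w ^ #T * (1 / 16) ^ #T)) := by
        gcongr
    _ = _ := by ring

lemma sum_mu_mul_largeFragmentCost_le {q w : ℝ} (hq : 0 ≤ q) (hw0 : 0 < w) (hw1 : w ≤ 1)
    (hqw : 16 * q ≤ w) {m : ℕ} {H : Finset (Finset X)} (hH : ∀ S ∈ H, #S ≤ 2 * m + 1) :
    ∑ W, mu w W * largeFragmentCost q m H W ≤ (1 / 16) * (1 / 4) ^ m := by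
  classical
  have hedge : ∀ Z : Finset X, ∃ E : Finset X, #E ≤ 2 * m + 1 ∧
      ∀ W T, T ∈ minFragments H W → W ∪ T = Z → T ⊆ E := by
    intro Z
    by_cases h : ∃ S ∈ H, S ⊆ Z
    · obtain ⟨S, hS, hSZ⟩ := h
      exact ⟨S, hH S hS, fun W T hT hZ => minFragments_subset hT hS (hZ ▸ hSZ)⟩
    · refine ⟨∅, by simp, fun W T hT hZ => absurd ?_ h⟩
      obtain ⟨S, hS, rfl⟩ := exists_of_mem_minFragments hT
      exact ⟨S, hS, by rw [← hZ]; simp⟩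
  choose E hE hET using hedge
  have hinj : Set.InjOn (fun x : Σ _ : Finset X, Finset X =>
      (⟨x.1 ∪ x.2, x.2⟩ : Σ _ : Finset X, Finset X))
      (univ.sigma fun W => {T ∈ minFragments H W | m < #T} :
        Finset (Σ _ : Finset X, Finset X)) := by
    rintro ⟨W, T⟩ hx ⟨W', T'⟩ hy hxy
    simp only [coe_sigma, Set.mem_sigma_iff, coe_univ, Set.mem_univ, true_and, coe_filter,
      Set.mem_ofPred_eq] at hx hy
    simp only [Sigma.mk.injEq, heq_eq_eq] at hxy
    obtain ⟨h1, rfl⟩ := hxy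
    have h2 := disjoint_of_mem_minFragments hx.1
    have h3 := disjoint_of_mem_minFragments hy.1
    have : W = W' := by
      rw [← union_sdiff_cancel_right h2, h1, union_sdiff_cancel_right h3]
    rw [this]
  calc ∑ W, mu w W * largeFragmentCost q m H W
      = ∑ x ∈ univ.sigma fun W => {T ∈ minFragments H W | m < #T}, mu w x.1 * q ^ #x.2 := by
        rw [Finset.sum_sigma]
        simp_rw [largeFragmentCost, Finset.mul_sum]
    _ ≤ ∑ x ∈ univ.sigma fun W => {T ∈ minFragments H W | m < #T},
          mu w (x.1 ∪ x.2) * (1 / 16) ^ #x.2 := by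
        refine Finset.sum_le_sum fun x hx => mu_mul_pow_le hq hw0 hw1 hqw ?_
        simp only [mem_sigma, mem_filter] at hx
        exact disjoint_of_mem_minFragments hx.2.1
    _ = ∑ y ∈ (univ.sigma fun W => {T ∈ minFragments H W | m < #T}).image
          (fun x : Σ _ : Finset X, Finset X =>
            (⟨x.1 ∪ x.2, x.2⟩ : Σ _ : Finset X, Finset X)),
          mu w y.1 * (1 / 16) ^ #y.2 := by
        rw [Finset.sum_image hinj]
    _ ≤ ∑ y ∈ univ.sigma fun Z => {T ∈ (E Z).powerset | m < #T},
          mu w y.1 * (1 / 16) ^ #y.2 := by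
        refine Finset.sum_le_sum_of_subset_of_nonneg ?_ fun y _ _ =>
          mul_nonneg (mu_nonneg hw0.le hw1 _) (by positivity)
        intro y hy
        obtain ⟨x, hx, rfl⟩ := mem_image.1 hy
        simp only [mem_sigma, mem_filter, mem_univ, true_and, mem_powerset] at hx ⊢
        exact ⟨hET _ _ _ hx.1 rfl, hx.2⟩
    _ = ∑ Z, mu w Z * ∑ T ∈ (E Z).powerset with m < #T, (1 / 16 : ℝ) ^ #T := by
        rw [Finset.sum_sigma]
        simp_rw [Finset.mul_sum]
    _ ≤ ∑ Z : Finset X, mu w Z * ((1 / 16) * (1 / 4) ^ m) := by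
        refine Finset.sum_le_sum fun Z _ =>
          mul_le_mul_of_nonneg_left ?_ (mu_nonneg hw0.le hw1 _)
        calc ∑ T ∈ (E Z).powerset with m < #T, (1 / 16 : ℝ) ^ #T
            ≤ ∑ T ∈ (E Z).powerset with m < #T, (1 / 16 : ℝ) ^ (m + 1) := by
              refine Finset.sum_le_sum fun T hT => ?_
              exact pow_le_pow_of_le_one (by norm_num) (by norm_num) (mem_filter.1 hT).2
          _ = #{T ∈ (E Z).powerset | m < #T} * (1 / 16 : ℝ) ^ (m + 1) := by simp
          _ ≤ 4 ^ m * (1 / 16 : ℝ) ^ (m + 1) := by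
              gcongr
              exact_mod_cast card_filter_powerset_le (hE Z)
          _ = (1 / 16) * (1 / 4) ^ m := by
              rw [pow_succ, ← mul_assoc, ← mul_pow]
              norm_num
              ring
    _ = (1 / 16) * (1 / 4) ^ m := by
        rw [← Finset.sum_mul, sum_mu, one_mul]

/-- Every cover of `H` has `q`-weight larger than `κ`. -/
def CoverCostGT (q κ : ℝ) (H : Finset (Finset X)) : Prop :=
  ∀ G : Finset (Finset X), IsCover G H → κ < ∑ T ∈ G, q ^ #T

lemma CoverCostGT.smallFragments {q κ : ℝ} (hq : 0 ≤ q) {H : Finset (Finset X)}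
    (h : CoverCostGT q κ H) (m : ℕ) (W : Finset X) :
    CoverCostGT q (κ - largeFragmentCost q m H W) {T ∈ minFragments H W | #T ≤ m} := by
  intro G hG
  have hcov : IsCover (G ∪ {T ∈ minFragments H W | m < #T}) H := by
    intro S hS
    obtain ⟨T, hT, hTS⟩ := exists_minimalsF_subset (mem_image_of_mem (· \ W) hS)
    rcases le_or_gt #T m with hm | hm
    · obtain ⟨U, hU, hUT⟩ := hG T (mem_filter.2 ⟨hT, hm⟩)
      exact ⟨U, mem_union_left _ hU, hUT.trans (hTS.trans sdiff_subset)⟩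
    · exact ⟨T, mem_union_right _ (mem_filter.2 ⟨hT, hm⟩), hTS.trans sdiff_subset⟩
  have h1 := h _ hcov
  have h2 := Finset.sum_union_inter (s₁ := G) (s₂ := {T ∈ minFragments H W | m < #T})
    (f := fun T => q ^ #T)
  have h3 : 0 ≤ ∑ T ∈ G ∩ {T ∈ minFragments H W | m < #T}, q ^ #T :=
    Finset.sum_nonneg fun T _ => pow_nonneg hq _
  unfold largeFragmentCost
  linarith

lemma threshold_step (ℓ : ℕ) (hℓ : ℓ ≠ 0) :
    1 / 2 * (1 - (1 / 2 : ℝ) ^ (ℓ / 2)) ≤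
      1 / 2 * (1 - (1 / 2 : ℝ) ^ ℓ) - 1 / 4 * (1 / 4) ^ (ℓ / 2) := by
  rcases Nat.eq_zero_or_pos (ℓ / 2) with h | h
  · have : ℓ = 1 := by omega
    subst this
    norm_num
  · have h1 : (1 / 2 : ℝ) ^ ℓ ≤ (1 / 2) ^ (2 * (ℓ / 2)) :=
      pow_le_pow_of_le_one (by norm_num) (by norm_num) (by omega)
    have h2 : (1 / 2 : ℝ) ^ (2 * (ℓ / 2)) = (1 / 4) ^ (ℓ / 2) := by rw [pow_mul]; norm_num
    have h3 : (1 / 4 : ℝ) ^ (ℓ / 2) = (1 / 2) ^ (ℓ / 2) * (1 / 2) ^ (ℓ / 2) := by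
      rw [← mul_pow]; norm_num
    have h4 : (1 / 2 : ℝ) ^ (ℓ / 2) ≤ 1 / 2 := by
      simpa using pow_le_pow_of_le_one (by norm_num : (0 : ℝ) ≤ 1 / 2) (by norm_num) h
    have h5 : (0 : ℝ) < (1 / 2) ^ (ℓ / 2) := by positivity
    nlinarith

lemma sum_mu_mul_avoid_union_le {v : ℝ} (hv0 : 0 ≤ v) (hv1 : v ≤ 1)
    {H H' : Finset (Finset X)} {W : Finset X}
    (h : ∀ V : Finset X, ∀ T ∈ H', T ⊆ V → ∃ S ∈ H, S ⊆ W ∪ V) :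
    ∑ V, mu v V * (if ∀ S ∈ H, ¬ S ⊆ W ∪ V then (1 : ℝ) else 0) ≤ avoidProb v H' := by
  refine Finset.sum_le_sum fun V _ => mul_le_mul_of_nonneg_left ?_ (mu_nonneg hv0 hv1 V)
  split_ifs with h1 h2 h2
  · exact le_rfl
  · push Not at h2
    obtain ⟨T, hT, hTV⟩ := h2
    obtain ⟨S, hS, hSW⟩ := h V T hT hTV
    exact absurd hSW (h1 S hS)
  · exact zero_le_one
  · exact le_rfl

/-- After `N` independent rounds of density `w ≥ 16 q`, a family of sets of size at most `ℓ`
without cheap covers is avoided with probability at most `ℓ ^ 2 / 2 ^ N`. -/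
theorem avoidProb_rounds_le {q w : ℝ} (hq : 0 ≤ q) (hw0 : 0 < w) (hw1 : w ≤ 1)
    (hqw : 16 * q ≤ w) (N : ℕ) : ∀ (ℓ : ℕ) (H : Finset (Finset X)), (∀ S ∈ H, #S ≤ ℓ) →
      CoverCostGT q (1 / 2 * (1 - (1 / 2) ^ ℓ)) H →
      avoidProb (1 - (1 - w) ^ N) H ≤ (ℓ : ℝ) ^ 2 * (1 / 2) ^ N := by
  have hv : ∀ N : ℕ, 0 ≤ 1 - (1 - w) ^ N ∧ 1 - (1 - w) ^ N ≤ 1 := fun N =>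
    ⟨sub_nonneg.2 (pow_le_one₀ (by linarith) (by linarith)),
      sub_le_self _ (pow_nonneg (by linarith) _)⟩
  have hzero : ∀ (v : ℝ) (H : Finset (Finset X)), (∀ S ∈ H, #S ≤ 0) →
      CoverCostGT q (1 / 2 * (1 - (1 / 2) ^ 0)) H → avoidProb v H = 0 := by
    intro v H hH hc
    obtain ⟨S, hS⟩ : H.Nonempty := by
      by_contra h
      have := hc ∅ (fun S hS => absurd ⟨S, hS⟩ h)
      simp at this
    have hS0 : S = ∅ := card_eq_zero.1 (Nat.le_zero.1 (hH S hS))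
    exact avoidProb_eq_zero (hS0 ▸ hS)
  induction N with
  | zero =>
    intro ℓ H hH hc
    rcases Nat.eq_zero_or_pos ℓ with rfl | hℓ
    · simp [hzero _ H hH hc]
    · refine (avoidProb_le_one (hv 0).1 (hv 0).2 H).trans ?_
      have : (1 : ℝ) ≤ ℓ := by exact_mod_cast hℓ
      rw [pow_zero, mul_one]
      exact one_le_pow₀ this
  | succ N ih =>
    intro ℓ H hH hc
    rcases Nat.eq_zero_or_pos ℓ with rfl | hℓ
    · simp [hzero _ H hH hc]
    set m := ℓ / 2 with hm
    set c : ℝ := (ℓ : ℝ) ^ 2 * (1 / 2) ^ N with hcdef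
    have hc0 : 0 ≤ c := by positivity
    have hδ : (0 : ℝ) < 1 / 4 * (1 / 4) ^ m := by positivity
    have hE := sum_mu_mul_largeFragmentCost_le hq hw0 hw1 hqw (m := m) (H := H)
      (fun S hS => (hH S hS).trans (by omega))
    have hround : ∀ W : Finset X,
        ∑ V, mu (1 - (1 - w) ^ N) V * (if ∀ S ∈ H, ¬ S ⊆ W ∪ V then (1 : ℝ) else 0) ≤
          c * (1 / 4 + largeFragmentCost q m H W / (1 / 4 * (1 / 4) ^ m)) := by
      intro W
      have hcost : 0 ≤ largeFragmentCost q m H W :=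
        Finset.sum_nonneg fun T _ => pow_nonneg hq _
      rcases le_or_gt (largeFragmentCost q m H W) (1 / 4 * (1 / 4) ^ m) with h | h
      · have h1 := ih m {T ∈ minFragments H W | #T ≤ m} (fun T hT => (mem_filter.1 hT).2)
          (fun G hG => by
            have h2 := hc.smallFragments hq m W G hG
            have h3 := threshold_step ℓ hℓ.ne'
            linarith)
        refine (sum_mu_mul_avoid_union_le (hv N).1 (hv N).2 ?_).trans (h1.trans ?_)
        · intro V T hT hTV
          obtain ⟨S, hS, rfl⟩ := exists_of_mem_minFragments (mem_filter.1 hT).1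
          exact ⟨S, hS, sdiff_le_iff.1 hTV⟩
        · have h4 : (m : ℝ) ≤ ℓ / 2 := by
            rw [le_div_iff₀ (by norm_num)]
            exact_mod_cast Nat.div_mul_le_self ℓ 2
          have h5 : (m : ℝ) ^ 2 * (1 / 2) ^ N ≤ (ℓ / 2 : ℝ) ^ 2 * (1 / 2) ^ N := by gcongr
          have h6 : 0 ≤ c * (largeFragmentCost q m H W / (1 / 4 * (1 / 4) ^ m)) := by positivity
          have h7 : (ℓ / 2 : ℝ) ^ 2 * (1 / 2) ^ N = c * (1 / 4) := by rw [hcdef]; ring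
          rw [mul_add]
          linarith
      · refine (sum_mu_mul_avoid_union_le (hv N).1 (hv N).2 ?_).trans ((ih ℓ H hH hc).trans ?_)
        · exact fun V T hT hTV => ⟨T, hT, hTV.trans subset_union_right⟩
        · have h1 : 1 ≤ largeFragmentCost q m H W / (1 / 4 * (1 / 4) ^ m) :=
            (one_le_div hδ).2 h.le
          exact le_mul_of_one_le_right hc0 (by linarith)
    calc avoidProb (1 - (1 - w) ^ (N + 1)) H
        = ∑ W, mu w W * ∑ V, mu (1 - (1 - w) ^ N) V *
            (if ∀ S ∈ H, ¬ S ⊆ W ∪ V then (1 : ℝ) else 0) := by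
          rw [sum_mu_mul_sum_mu_union w (1 - (1 - w) ^ N)
            (fun Z => if ∀ S ∈ H, ¬ S ⊆ Z then (1 : ℝ) else 0), avoidProb]
          congr! 3
          ring
      _ ≤ ∑ W, mu w W * (c * (1 / 4 + largeFragmentCost q m H W / (1 / 4 * (1 / 4) ^ m))) :=
          Finset.sum_le_sum fun W _ =>
            mul_le_mul_of_nonneg_left (hround W) (mu_nonneg hw0.le hw1 W)
      _ = c * (1 / 4 * ∑ W : Finset X, mu w W +
            (∑ W, mu w W * largeFragmentCost q m H W) / (1 / 4 * (1 / 4) ^ m)) := by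
          rw [Finset.mul_sum, Finset.sum_div, ← Finset.sum_add_distrib, Finset.mul_sum]
          exact Finset.sum_congr rfl fun W _ => by ring
      _ ≤ c * (1 / 4 * 1 + 1 / 4) := by
          rw [sum_mu]
          refine mul_le_mul_of_nonneg_left (add_le_add_right ?_ _) hc0
          rw [div_le_iff₀ hδ]
          linarith
      _ = (ℓ : ℝ) ^ 2 * (1 / 2) ^ (N + 1) := by
          rw [hcdef, pow_succ]
          ring

lemma qThr_bddAbove (F : Finset (Finset X)) :
    BddAbove {p : ℝ | p ∈ Set.Icc (0 : ℝ) 1 ∧ PSmall p F} :=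
  ⟨1, fun _ h => h.1.2⟩

lemma qThr_nonneg (F : Finset (Finset X)) : 0 ≤ qThr F :=
  Real.sSup_nonneg fun _ h => h.1.1

lemma muF_add_muF_compl (p : ℝ) (F : Finset (Finset X)) : muF p F + muF p Fᶜ = 1 := by
  unfold muF
  rw [Finset.sum_add_sum_compl, sum_mu]

lemma avoidProb_minimalsF {F : Finset (Finset X)} (hF : IsUpperFam F) (p : ℝ) :
    avoidProb p (minimalsF F) = muF p Fᶜ := by
  unfold avoidProb muF
  simp_rw [mul_ite, mul_one, mul_zero]
  rw [← Finset.sum_filter]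
  refine Finset.sum_congr ?_ fun _ _ => rfl
  ext W
  simp only [mem_filter, mem_univ, true_and, mem_compl]
  constructor
  · intro h hW
    obtain ⟨T, hT, hTW⟩ := exists_minimalsF_subset hW
    exact h T hT hTW
  · exact fun h S hS hSW => h (hF S (mem_filter.1 hS).1 W hSW)

lemma muF_powerset_compl (p : ℝ) (V : Finset X) : muF p (Vᶜ.powerset) = (1 - p) ^ #V := by
  have hV := card_le_univ V
  have h : ∀ S ∈ Vᶜ.powerset, mu p S =
      (1 - p) ^ #V * (p ^ #S * (1 - p) ^ (#Vᶜ - #S)) := by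
    intro S hS
    have h1 := card_le_card (mem_powerset.1 hS)
    rw [card_compl] at h1 ⊢
    have h2 : Fintype.card X - #S = #V + (Fintype.card X - #V - #S) := by omega
    unfold mu
    rw [h2, pow_add]
    ring
  unfold muF
  rw [Finset.sum_congr rfl h, ← Finset.mul_sum, Finset.sum_pow_mul_eq_add_pow]
  simp

lemma card_le_ell0 {F : Finset (Finset X)} {S : Finset X} (hS : S ∈ minimalsF F) :
    #S ≤ ell0 F :=
  Finset.le_sup (f := Finset.card) hS

lemma one_le_ell0 {F : Finset (Finset X)} (hne : F.Nonempty) (h0 : ∅ ∉ F) : 1 ≤ ell0 F := by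
  obtain ⟨S, hS⟩ := hne
  obtain ⟨T, hT, -⟩ := exists_minimalsF_subset hS
  refine le_trans ?_ (card_le_ell0 hT)
  rw [Nat.one_le_iff_ne_zero, Ne, card_eq_zero]
  rintro rfl
  exact h0 (mem_filter.1 hT).1

/-- The case of families generated by singletons. -/
lemma muF_compl_lt_of_ell0_eq_one {F : Finset (Finset X)} (hF : IsUpperFam F)
    (hne : F.Nonempty) (h0 : ∅ ∉ F) (h1 : ell0 F = 1) {ε p : ℝ} (hε0 : 0 < ε) (hε1 : ε < 1)
    (hp0 : 0 < p) (hp1 : p < 1) (hbig : 48 * qThr F * Real.logb 2 (1 / ε) < p) :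
    muF p Fᶜ < ε := by
  set V : Finset X := univ.filter fun v => {v} ∈ F with hVdef
  have hsub : ∀ S ∈ F, ∃ v ∈ V, v ∈ S := by
    intro S hS
    obtain ⟨T, hT, hTS⟩ := exists_minimalsF_subset hS
    have hTF := (mem_filter.1 hT).1
    have h2 : #T ≠ 0 := fun h => h0 (card_eq_zero.1 h ▸ hTF)
    have h3 := card_le_ell0 hT
    obtain ⟨v, rfl⟩ := card_eq_one.1 (by omega : #T = 1)
    exact ⟨v, by simpa [hVdef] using hTF, hTS (mem_singleton_self v)⟩
  have hVpos : 0 < #V := by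
    obtain ⟨S, hS⟩ := hne
    obtain ⟨v, hv, -⟩ := hsub S hS
    exact card_pos.2 ⟨v, hv⟩
  have hV1 : (1 : ℝ) ≤ #V := by exact_mod_cast hVpos
  have hq : 1 / (2 * (#V : ℝ)) ≤ qThr F := by
    refine le_csSup (qThr_bddAbove F) ⟨⟨by positivity, ?_⟩, V.image fun v => {v}, ?_, ?_⟩
    · rw [div_le_one (by positivity)]
      linarith
    · intro S hS
      obtain ⟨v, hv, hvS⟩ := hsub S hS
      exact ⟨{v}, mem_image_of_mem _ hv, singleton_subset_iff.2 hvS⟩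
    · rw [Finset.sum_image (fun a _ b _ h => singleton_injective h)]
      simp only [card_singleton, pow_one, sum_const, nsmul_eq_mul]
      apply le_of_eq
      field_simp
  have hΛ : 0 < Real.log (1 / ε) := Real.log_pos ((one_lt_div hε0).2 hε1)
  have hlog : Real.log (1 / ε) ≤ Real.logb 2 (1 / ε) := by
    rw [Real.logb, le_div_iff₀ (Real.log_pos (by norm_num))]
    nlinarith [Real.log_two_lt_d9]
  have hpV : Real.log (1 / ε) < p * #V := by
    have h2 : 48 * (1 / (2 * (#V : ℝ))) * Real.log (1 / ε) < p := by
      refine lt_of_le_of_lt ?_ hbig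
      gcongr
      exact mul_nonneg (by norm_num) (qThr_nonneg F)
    have h3 : 48 * (1 / (2 * (#V : ℝ))) * Real.log (1 / ε) * #V = 24 * Real.log (1 / ε) := by
      field_simp
      ring
    have h4 := mul_lt_mul_of_pos_right h2 (by linarith : (0 : ℝ) < #V)
    linarith
  calc muF p Fᶜ ≤ muF p Vᶜ.powerset := by
        refine Finset.sum_le_sum_of_subset_of_nonneg ?_ fun S _ _ => mu_nonneg hp0.le hp1.le S
        intro S hS
        rw [mem_powerset]
        intro v hv
        rw [mem_compl]
        intro hvV
        exact mem_compl.1 hS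
          (hF {v} (by simpa [hVdef] using hvV) S (singleton_subset_iff.2 hv))
    _ = (1 - p) ^ #V := muF_powerset_compl p V
    _ ≤ Real.exp (-p) ^ #V :=
        pow_le_pow_left₀ (by linarith) (by linarith [Real.add_one_le_exp (-p)]) _
    _ = Real.exp (-(p * #V)) := by
        rw [← Real.exp_nat_mul]
        ring_nf
    _ < Real.exp (-Real.log (1 / ε)) := Real.exp_lt_exp.2 (by linarith)
    _ = ε := by
        rw [one_div, Real.log_inv, neg_neg, Real.exp_log hε0]

lemma muF_compl_lt_of_two_le_ell0 {F : Finset (Finset X)} (hF : IsUpperFam F)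
    (h2 : 2 ≤ ell0 F) {ε p : ℝ} (hε0 : 0 < ε) (hε1 : ε < 1) (hp0 : 0 < p) (hp1 : p < 1)
    (hbig : 48 * qThr F * Real.logb 2 ((ell0 F : ℝ) / ε) < p) :
    muF p Fᶜ < ε := by
  set ℓ := ell0 F
  set Λ := Real.logb 2 ((ℓ : ℝ) / ε) with hΛdef
  have hℓ : (2 : ℝ) ≤ ℓ := by exact_mod_cast h2
  have hℓε : (2 : ℝ) ≤ ℓ / ε := by
    rw [le_div_iff₀ hε0]
    nlinarith
  have hΛ : 1 ≤ Λ := by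
    rw [hΛdef, Real.le_logb_iff_rpow_le (by norm_num) (by linarith), Real.rpow_one]
    exact hℓε
  set q := p / (48 * Λ) with hqdef
  have hq0 : 0 < q := by positivity
  have hqthr : qThr F < q := by
    rw [hqdef, lt_div_iff₀ (by positivity)]
    linarith
  have hq1 : q ≤ 1 := by
    rw [hqdef, div_le_one (by positivity)]
    linarith
  have hns : ¬ PSmall q F := fun h =>
    absurd (le_csSup (qThr_bddAbove F) ⟨⟨hq0.le, hq1⟩, h⟩) (not_le.2 hqthr)
  have hcost : CoverCostGT q (1 / 2 * (1 - (1 / 2) ^ ℓ)) (minimalsF F) := by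
    intro G hG
    by_contra h
    refine hns ⟨G, fun S hS => ?_, ?_⟩
    · obtain ⟨T, hT, hTS⟩ := exists_minimalsF_subset hS
      obtain ⟨U, hU, hUT⟩ := hG T hT
      exact ⟨U, hU, hUT.trans hTS⟩
    · have : (0 : ℝ) < (1 / 2) ^ ℓ := by positivity
      linarith
  set N := ⌈2 * Λ⌉₊ with hNdef
  have hN1 : 2 * Λ ≤ N := Nat.le_ceil _
  have hN2 : (N : ℝ) ≤ 3 * Λ := by
    have := Nat.ceil_lt_add_one (by positivity : 0 ≤ 2 * Λ)
    linarith
  have hN0 : N ≠ 0 := by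
    rintro h
    rw [h] at hN1
    simp at hN1
    linarith
  have hNpos : (0 : ℝ) < N := by positivity
  set w := 1 - (1 - p) ^ (1 / (N : ℝ)) with hwdef
  have hroot : (1 - w) ^ N = 1 - p := by
    rw [hwdef, sub_sub_cancel, one_div, Real.rpow_inv_natCast_pow (by linarith) hN0]
  have hw1 : w ≤ 1 := by
    have : 0 ≤ (1 - p) ^ (1 / (N : ℝ)) := Real.rpow_nonneg (by linarith) _
    linarith
  have hpN : p / N ≤ w := by
    by_contra! hlt
    have hpN1 : p / N ≤ 1 := by
      rw [div_le_one hNpos]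
      linarith
    have h3 : 1 - p ≤ (1 - p / N) ^ N := by
      have := one_add_mul_le_pow (a := -(p / N)) (by linarith) N
      have h4 : (N : ℝ) * -(p / N) = -p := by field_simp
      rw [h4] at this
      simpa [sub_eq_add_neg] using this
    have h5 : (1 - p / N) ^ N < (1 - w) ^ N :=
      pow_lt_pow_left₀ (by linarith) (by linarith) hN0
    linarith
  have hqw : 16 * q ≤ w := by
    refine le_trans ?_ hpN
    rw [le_div_iff₀ hNpos]
    calc 16 * q * N ≤ 16 * q * (3 * Λ) := by gcongr
      _ = p := by
        rw [hqdef]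
        field_simp
        norm_num
  have hmain := avoidProb_rounds_le hq0.le (by linarith) hw1 hqw N ℓ (minimalsF F)
    (fun S hS => card_le_ell0 hS) hcost
  rw [hroot, sub_sub_cancel, avoidProb_minimalsF hF] at hmain
  have hpow : (1 / 2 : ℝ) ^ N ≤ (ε / ℓ) ^ 2 := by
    have h3 : (ℓ / ε : ℝ) ^ 2 ≤ 2 ^ N := by
      rw [← Real.rpow_natCast 2 N]
      calc (ℓ / ε : ℝ) ^ 2 = (2 : ℝ) ^ (2 * Λ) := by
            rw [mul_comm, Real.rpow_mul (by norm_num), hΛdef,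
              Real.rpow_logb (by norm_num) (by norm_num) (by positivity)]
            norm_cast
        _ ≤ (2 : ℝ) ^ (N : ℝ) := Real.rpow_le_rpow_of_exponent_le (by norm_num) hN1
    rw [one_div, inv_pow, ← inv_div (ℓ : ℝ) ε, inv_pow]
    exact inv_anti₀ (by positivity) h3
  calc muF p Fᶜ ≤ (ℓ : ℝ) ^ 2 * (1 / 2) ^ N := hmain
    _ ≤ (ℓ : ℝ) ^ 2 * (ε / ℓ) ^ 2 := by gcongr
    _ = ε ^ 2 := by field_simp
    _ < ε := by nlinarith

/-- The Park–Pham theorem with optimal dependence on the error probability. -/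
theorem one_sub_lt_muF {F : Finset (Finset X)} (hF : IsUpperFam F)
    (hne : F.Nonempty) (h0 : ∅ ∉ F) {ε p : ℝ} (hε0 : 0 < ε) (hε1 : ε < 1)
    (hp0 : 0 < p) (hp1 : p < 1)
    (hbig : 48 * qThr F * Real.logb 2 ((ell0 F : ℝ) / ε) < p) : 1 - ε < muF p F := by
  have h : muF p Fᶜ < ε := by
    rcases (one_le_ell0 hne h0).eq_or_lt with h1 | h2
    · refine muF_compl_lt_of_ell0_eq_one hF hne h0 h1.symm hε0 hε1 hp0 hp1 ?_
      rw [← h1, Nat.cast_one] at hbig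
      exact hbig
    · exact muF_compl_lt_of_two_le_ell0 hF h2 hε0 hε1 hp0 hp1 hbig
  linarith [muF_add_muF_compl p F]

lemma isUpperFam_upClos (A : Finset (Finset X)) : IsUpperFam (upClos A) := by
  intro S hS T hST
  obtain ⟨U, hU, hUS⟩ := (mem_filter.1 hS).2
  exact mem_filter.2 ⟨mem_univ _, U, hU, hUS.trans hST⟩

lemma subset_upClos (A : Finset (Finset X)) : A ⊆ upClos A :=
  fun S hS => mem_filter.2 ⟨mem_univ _, S, hS, Subset.rfl⟩

lemma empty_notMem_upClos {A : Finset (Finset X)} (h : ∅ ∉ A) : ∅ ∉ upClos A := by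
  intro h1
  obtain ⟨U, hU, hU0⟩ := (mem_filter.1 h1).2
  exact h (subset_empty.1 hU0 ▸ hU)

end ParkPham

/-- **Remark (ε-dependent bound when the ratio is at least 1).** For `∅ ≠ A ⊆ B ⊆ 2^X` with
`∅ ∉ A`, `ε ∈ (0,1)` and `p ∈ (0,1)`: if `r_{A,B}(p) ≥ 1` and
`p > 48 · q(⟨A⟩) · log₂(ℓ₀(⟨A⟩)/ε)`, then `P(X_p ∈ A | X_p ∈ B) > 1 - ε`. -/
theorem eps_bound_of_ratio_ge_one (X : Type) [Fintype X] [DecidableEq X] [Nonempty X]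
    (A B : Finset (Finset X)) (hA : A ≠ ∅) (hAB : A ⊆ B) (hnt : ∅ ∉ A)
    (ε : ℝ) (hε : ε ∈ Set.Ioo (0 : ℝ) 1) (p : ℝ) (hp : p ∈ Set.Ioo (0 : ℝ) 1)
    (hr : rAB A B p ≥ 1)
    (hbig : p > 48 * qThr (upClos A) * Real.logb 2 ((ell0 (upClos A) : ℝ) / ε)) :
    muF p A / muF p B > 1 - ε := by
  have hlt := one_sub_lt_muF (isUpperFam_upClos A)
    ((nonempty_iff_ne_empty.2 hA).mono (subset_upClos A)) (empty_notMem_upClos hnt)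
    hε.1 hε.2 hp.1 hp.2 hbig
  have hpos : 0 < muF p (upClos A) := by linarith [hε.2]
  have h : rAB A B p = muF p A / muF p B / muF p (upClos A) := by
    rw [rAB, div_right_comm]
  rw [h, ge_iff_le, le_div_iff₀ hpos, one_mul] at hr
  exact lt_of_lt_of_le hlt hr
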